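/- Let q ≥ 1, m ≥ 2, ξ = exp(2πj/q), and y ∈ ℂ^{2^m}. For each integer i with 0 ≤ i < q define z(i) ∈ ℂ^{2^{m-1}} by z_k(i) = y_k + y_{k+2^{m-1}}·ξ^{-i}. Then the maximum of Re⟨y,x⟩ over all polyphase codewords x of RM_q(1,m) equals the maximum over i ∈ {0,…,q−1} of the maximum of Re⟨z(i),w⟩ over all polyphase codewords w of RM_q(1,m−1). -/

import Mathlib

open Matrix Complex Finset

noncomputable section

/-- `2 ^ (m + 1) = 2 ^ m + 2 ^ m`. -/
theorem two_pow_succ' (m : ℕ) : 2 ^ (m + 1) = 2 ^ m + 2 ^ m := by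
  rw [pow_succ, mul_two]

/-- The generator matrix `G m` of the generalized first-order Reed–Muller code,
defined recursively: `G 1` is the 2×2 identity matrix, and
`G m = [[G (m-1), G (m-1)], [0, 1]]` for `m ≥ 2`.  (The value at `m = 0` is a
dummy that is never used, since all statements assume `m ≥ 1`.) -/
def G : (m : ℕ) → Matrix (Fin (m + 1)) (Fin (2 ^ m)) ℤ
  | 0 => Matrix.of fun _ _ => 1
  | 1 => 1
  | (m + 2) => Matrix.of fun i k =>
      if hi : (i : ℕ) < m + 2 then
        G (m + 1) ⟨i, hi⟩ ⟨(k : ℕ) % 2 ^ (m + 1), Nat.mod_lt _ (by positivity)⟩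
      else if (k : ℕ) < 2 ^ (m + 1) then 0 else 1

/-- The generalized first-order Reed–Muller code `RM_q(1,m)`, the set of vectors
`u · G_m (mod q)` for `u ∈ (ℤ/qℤ)^{m+1}`. -/
def RM (q m : ℕ) : Set (Fin (2 ^ m) → ZMod q) :=
  {c | ∃ u : Fin (m + 1) → ZMod q, c = u ᵥ* ((G m).map (Int.cast : ℤ → ZMod q))}

/-- `ξ = exp(2πj/q)`, a primitive `q`-th root of unity. -/
def xi (q : ℕ) : ℂ := Complex.exp (2 * Real.pi * Complex.I / q)

/-- The polyphase codewords of `RM_q(1,m)`: vectors `ξ^c` for `c ∈ RM_q(1,m)`. -/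
def polyRM (q m : ℕ) : Set (Fin (2 ^ m) → ℂ) :=
  {x | ∃ c ∈ RM q m, x = fun k => xi q ^ (c k).val}

/-- Complex dot product `⟨y, x⟩ = Σ_k y_k conj(x_k)`. -/
def dotc {n : ℕ} (y x : Fin n → ℂ) : ℂ := ∑ k, y k * (starRingEnd ℂ) (x k)

/-- Squared Euclidean distance `‖y - x‖²`. -/
def dist2 {n : ℕ} (y x : Fin n → ℂ) : ℝ := ∑ k, Complex.normSq (y k - x k)

/-- Concatenation `(a | b)` of two vectors of length `2^m`, as a vector of
length `2^(m+1)`. -/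
def rmAppend {α : Type*} {m : ℕ} (a b : Fin (2 ^ m) → α) : Fin (2 ^ (m + 1)) → α :=
  fun k => Fin.append a b (Fin.cast (two_pow_succ' m) k)

/-- The index `k` viewed in the first half of `Fin (2^(m+1))`. -/
def loIdx (m : ℕ) (k : Fin (2 ^ m)) : Fin (2 ^ (m + 1)) :=
  Fin.cast (two_pow_succ' m).symm (Fin.castAdd (2 ^ m) k)

/-- The index `k + 2^m` in the second half of `Fin (2^(m+1))`. -/
def hiIdx (m : ℕ) (k : Fin (2 ^ m)) : Fin (2 ^ (m + 1)) :=
  Fin.cast (two_pow_succ' m).symm (Fin.natAdd (2 ^ m) k)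

theorem xi_pow_q (q : ℕ) (hq : 1 ≤ q) : xi q ^ q = 1 := by
  have : (q : ℂ) ≠ 0 := by exact_mod_cast (by omega : q ≠ 0)
  rw [xi, ← Complex.exp_nat_mul, mul_div_cancel₀ _ this, Complex.exp_two_pi_mul_I]

theorem xi_ne_zero (q : ℕ) : xi q ≠ 0 := Complex.exp_ne_zero _

theorem conj_xi (q : ℕ) : (starRingEnd ℂ) (xi q) = (xi q)⁻¹ := by
  rw [xi, ← Complex.exp_conj, ← Complex.exp_neg]
  congr 1
  have h2 : (starRingEnd ℂ) 2 = 2 := Complex.conj_ofNat 2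
  simp [neg_div, h2]

theorem xi_val_add (q : ℕ) (hq : 1 ≤ q) (a b : ZMod q) :
    xi q ^ (a + b).val = xi q ^ a.val * xi q ^ b.val := by
  have : NeZero q := ⟨by omega⟩
  rw [ZMod.val_add, ← pow_add]
  conv_rhs => rw [← Nat.mod_add_div (a.val + b.val) q, pow_add, pow_mul, xi_pow_q q hq, one_pow,
    mul_one]

theorem enc_lo (q m : ℕ) (hm : 1 ≤ m) (u : Fin (m + 2) → ZMod q) (k : Fin (2 ^ m)) :
    (u ᵥ* ((G (m + 1)).map (Int.cast : ℤ → ZMod q))) (loIdx m k) =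
      ((fun i : Fin (m + 1) => u i.castSucc) ᵥ* ((G m).map (Int.cast : ℤ → ZMod q))) k := by
  obtain ⟨m, rfl⟩ : ∃ n, m = n + 1 := ⟨m - 1, by omega⟩
  have hk := k.isLt
  simp only [Matrix.vecMul, dotProduct, Matrix.map_apply]
  rw [Fin.sum_univ_castSucc]
  simp [G, loIdx, Nat.mod_eq_of_lt hk]

theorem enc_hi (q m : ℕ) (hm : 1 ≤ m) (u : Fin (m + 2) → ZMod q) (k : Fin (2 ^ m)) :
    (u ᵥ* ((G (m + 1)).map (Int.cast : ℤ → ZMod q))) (hiIdx m k) =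
      ((fun i : Fin (m + 1) => u i.castSucc) ᵥ* ((G m).map (Int.cast : ℤ → ZMod q))) k
        + u (Fin.last _) := by
  obtain ⟨m, rfl⟩ : ∃ n, m = n + 1 := ⟨m - 1, by omega⟩
  have hk := k.isLt
  simp only [Matrix.vecMul, dotProduct, Matrix.map_apply]
  rw [Fin.sum_univ_castSucc]
  simp [G, hiIdx, Nat.mod_eq_of_lt hk]

theorem sum_halves (m : ℕ) (f : Fin (2 ^ (m + 1)) → ℂ) :
    ∑ k, f k = ∑ k, (f (loIdx m k) + f (hiIdx m k)) := by
  rw [Finset.sum_add_distrib, ← (finCongr (two_pow_succ' m).symm).sum_comp, Fin.sum_univ_add]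
  rfl

theorem dot_key (q m : ℕ) (hq : 1 ≤ q) (hm : 1 ≤ m) (y : Fin (2 ^ (m + 1)) → ℂ)
    (z : ℕ → Fin (2 ^ m) → ℂ)
    (hz : ∀ i k, z i k = y (loIdx m k) + y (hiIdx m k) * xi q ^ (-(i : ℤ)))
    (u : Fin (m + 2) → ZMod q) :
    dotc y (fun k => xi q ^ ((u ᵥ* ((G (m + 1)).map (Int.cast : ℤ → ZMod q))) k).val) =
      dotc (z (u (Fin.last _)).val) (fun k => xi q ^ (((fun i : Fin (m + 1) => u i.castSucc) ᵥ*
        ((G m).map (Int.cast : ℤ → ZMod q))) k).val) := by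
  rw [dotc, sum_halves, dotc]
  refine Finset.sum_congr rfl fun k _ => ?_
  rw [enc_lo q m hm, enc_hi q m hm, xi_val_add q hq, hz]
  simp only [map_mul, map_pow, conj_xi, _root_.zpow_neg, zpow_natCast, inv_pow]
  ring

theorem polyRM_finite (q m : ℕ) (hq : 1 ≤ q) : (polyRM q m).Finite := by
  have : NeZero q := ⟨by omega⟩
  have : polyRM q m = (fun (c : Fin (2 ^ m) → ZMod q) k => xi q ^ (c k).val) '' RM q m := by
    ext x
    simp [polyRM, eq_comm]
  rw [this]
  exact (Set.toFinite _).image _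

theorem polyRM_nonempty (q m : ℕ) : (polyRM q m).Nonempty := ⟨_, _, ⟨0, rfl⟩, rfl⟩

theorem sSup_two {α : Type*} (W : Set α) (hW : W.Finite) (hne : W.Nonempty) (q : ℕ)
    (hq : 1 ≤ q) (f : ℕ → α → ℝ) :
    sSup {r : ℝ | ∃ i < q, ∃ w ∈ W, r = f i w} =
      sSup {r : ℝ | ∃ i < q, r = sSup {s : ℝ | ∃ w ∈ W, s = f i w}} := by
  obtain ⟨w0, hw0⟩ := hne
  have hin : ∀ i, BddAbove {s : ℝ | ∃ w ∈ W, s = f i w} := fun i => by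
    refine ((hW.image (f i)).subset ?_).bddAbove
    rintro _ ⟨w, hw, rfl⟩
    exact ⟨w, hw, rfl⟩
  have hout : BddAbove {r : ℝ | ∃ i < q, r = sSup {s : ℝ | ∃ w ∈ W, s = f i w}} := by
    refine (((Set.finite_Iio q).image fun i => sSup {s : ℝ | ∃ w ∈ W, s = f i w}).subset
      ?_).bddAbove
    rintro _ ⟨i, hi, rfl⟩
    exact ⟨i, hi, rfl⟩
  have hall : BddAbove {r : ℝ | ∃ i < q, ∃ w ∈ W, r = f i w} := by
    refine ((((Set.finite_Iio q).prod hW).image fun p => f p.1 p.2).subset ?_).bddAbove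
    rintro _ ⟨i, hi, w, hw, rfl⟩
    exact ⟨(i, w), ⟨hi, hw⟩, rfl⟩
  apply le_antisymm
  · refine csSup_le ⟨_, 0, hq, w0, hw0, rfl⟩ ?_
    rintro _ ⟨i, hi, w, hw, rfl⟩
    exact (le_csSup (hin i) ⟨w, hw, rfl⟩).trans (le_csSup hout ⟨i, hi, rfl⟩)
  · refine csSup_le ⟨_, 0, hq, rfl⟩ ?_
    rintro _ ⟨i, hi, rfl⟩
    refine csSup_le ⟨_, w0, hw0, rfl⟩ ?_
    rintro _ ⟨w, hw, rfl⟩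
    exact le_csSup hall ⟨i, hi, w, hw, rfl⟩

/-- With `z_k(i) = y_k + y_{k+2^m} ξ^{-i}` for `0 ≤ i < q`,
the maximum of `Re⟨y,x⟩` over polyphase codewords `x` of `RM_q(1,m+1)` equals
the maximum over `i ∈ {0,…,q−1}` of the maximum of `Re⟨z(i),w⟩` over polyphase
codewords `w` of `RM_q(1,m)`.  (The paper's `m ≥ 2` is written as `m + 1`,
`m ≥ 1`.) -/
theorem stmt8 (q m : ℕ) (hq : 1 ≤ q) (hm : 1 ≤ m) (y : Fin (2 ^ (m + 1)) → ℂ)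
    (z : ℕ → Fin (2 ^ m) → ℂ)
    (hz : ∀ i k, z i k = y (loIdx m k) + y (hiIdx m k) * xi q ^ (-(i : ℤ))) :
    sSup {r : ℝ | ∃ x ∈ polyRM q (m + 1), r = (dotc y x).re} =
      sSup {r : ℝ | ∃ i < q,
        r = sSup {s : ℝ | ∃ w ∈ polyRM q m, s = (dotc (z i) w).re}} := by
  rw [← sSup_two (polyRM q m) (polyRM_finite q m hq) (polyRM_nonempty q m) q hq
    (fun i w => (dotc (z i) w).re)]
  have : NeZero q := ⟨by omega⟩
  congr 1
  ext r
  constructor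
  · rintro ⟨_, ⟨_, ⟨u, rfl⟩, rfl⟩, rfl⟩
    exact ⟨(u (Fin.last _)).val, ZMod.val_lt _, _, ⟨_, ⟨_, rfl⟩, rfl⟩,
      congrArg Complex.re (dot_key q m hq hm y z hz u)⟩
  · rintro ⟨i, hi, _, ⟨_, ⟨v, rfl⟩, rfl⟩, rfl⟩
    refine ⟨_, ⟨_, ⟨Fin.snoc (α := fun _ => ZMod q) v (i : ZMod q), rfl⟩, rfl⟩, ?_⟩
    rw [dot_key q m hq hm y z hz]
    simp [ZMod.val_natCast, Nat.mod_eq_of_lt hi]
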